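/- arXiv:1909.07622 — 7 statements merged into one kernel-verified Lean document; each statement's English description precedes it below -/
import Mathlib

section
/- Let H be a nonzero real symmetric d×d matrix all of whose columns h_1, …, h_d are nonzero, let P ∈ ℝ^{d²×d} be the matrix whose i-th column is e_i ⊗ (h_i/‖h_i‖), and let Q ∈ ℝ^{d²×d} be the matrix whose j-th column is ((1/‖H‖_F) Σ_{i=1}^d ‖h_i‖ e_i) ⊗ e_j. If u ∈ ℝ^d is a unit vector with Hu = λu, then ⟨Pu, Qu⟩ = λ/‖H‖_F, ‖(Pu − Qu)/2‖² = (1 − λ/‖H‖_F)/2, and ‖(Pu + Qu)/2‖² = (1 + λ/‖H‖_F)/2. -/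
open scoped BigOperators Matrix

/-- Let `H` be a nonzero real symmetric `d×d` matrix with nonzero columns, `P` and `Q`
as in the PNED construction, and `u` a unit eigenvector of `H` with eigenvalue `λ`.
Then `⟨Pu, Qu⟩ = λ/‖H‖_F`, `‖(Pu − Qu)/2‖² = (1 − λ/‖H‖_F)/2` and
`‖(Pu + Qu)/2‖² = (1 + λ/‖H‖_F)/2`. -/
theorem PNED_probabilities {d : ℕ} (H : Matrix (Fin d) (Fin d) ℝ) (hH : H ≠ 0)
    (hsymm : H.IsSymm)
    (hcol : ∀ k, (fun j => H j k) ≠ (0 : Fin d → ℝ))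
    (P Q : Matrix (Fin d × Fin d) (Fin d) ℝ)
    (hP : ∀ i j k, P (i, j) k =
      (if i = k then (1 : ℝ) else 0) * (H j k / Real.sqrt (∑ a, H a k ^ 2)))
    (hQ : ∀ i j k, Q (i, j) k =
      (Real.sqrt (∑ a, H a i ^ 2) / Real.sqrt (∑ a, ∑ b, H a b ^ 2)) *
        (if j = k then (1 : ℝ) else 0))
    (u : Fin d → ℝ) (hu : ∑ i, u i ^ 2 = 1) (lam : ℝ)
    (heig : H.mulVec u = lam • u) :
    (∑ x : Fin d × Fin d, P.mulVec u x * Q.mulVec u x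
        = lam / Real.sqrt (∑ a, ∑ b, H a b ^ 2)) ∧
    (∑ x : Fin d × Fin d, ((P.mulVec u x - Q.mulVec u x) / 2) ^ 2
        = (1 - lam / Real.sqrt (∑ a, ∑ b, H a b ^ 2)) / 2) ∧
    (∑ x : Fin d × Fin d, ((P.mulVec u x + Q.mulVec u x) / 2) ^ 2
        = (1 + lam / Real.sqrt (∑ a, ∑ b, H a b ^ 2)) / 2) := by
  have hs : ∀ k, 0 < Real.sqrt (∑ a, H a k ^ 2) := fun k => by
    obtain ⟨j, hj⟩ := Function.ne_iff.mp (hcol k)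
    exact Real.sqrt_pos.mpr (Finset.sum_pos' (fun a _ => sq_nonneg _)
      ⟨j, Finset.mem_univ j, sq_pos_of_ne_zero hj⟩)
  have hF : 0 < ∑ a, ∑ b, H a b ^ 2 := by
    obtain ⟨i, hi⟩ := Function.ne_iff.mp hH
    obtain ⟨j, hj⟩ := Function.ne_iff.mp hi
    exact Finset.sum_pos' (fun a _ => Finset.sum_nonneg fun b _ => sq_nonneg _)
      ⟨i, Finset.mem_univ i, Finset.sum_pos' (fun b _ => sq_nonneg _)
        ⟨j, Finset.mem_univ j, sq_pos_of_ne_zero hj⟩⟩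
  have hs_sq : ∀ k, Real.sqrt (∑ a, H a k ^ 2) ^ 2 = ∑ a, H a k ^ 2 := fun k =>
    Real.sq_sqrt (Finset.sum_nonneg fun a _ => sq_nonneg _)
  have hF_sq : Real.sqrt (∑ a, ∑ b, H a b ^ 2) ^ 2 = ∑ a, ∑ b, H a b ^ 2 :=
    Real.sq_sqrt hF.le
  have hF_pos := Real.sqrt_pos.mpr hF
  have hPu : ∀ i j, P.mulVec u (i, j) = H j i / Real.sqrt (∑ a, H a i ^ 2) * u i := fun i j => by
    simp [Matrix.mulVec, dotProduct, hP]
  have hQu : ∀ i j, Q.mulVec u (i, j) =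
      Real.sqrt (∑ a, H a i ^ 2) / Real.sqrt (∑ a, ∑ b, H a b ^ 2) * u j := fun i j => by
    simp [Matrix.mulVec, dotProduct, hQ]
  have inner_PQ : ∑ x : Fin d × Fin d, P.mulVec u x * Q.mulVec u x
      = lam / Real.sqrt (∑ a, ∑ b, H a b ^ 2) := by
    have hquad : ∑ j, ∑ i, H j i * u i * u j = lam := by
      have hrow : ∀ j, ∑ i, H j i * u i = lam * u j := fun j => congrFun heig j
      simp_rw [← Finset.sum_mul, hrow, mul_assoc, ← Finset.mul_sum, ← sq, hu, mul_one]
    rw [Fintype.sum_prod_type_right, ← hquad, Finset.sum_div]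
    refine Finset.sum_congr rfl fun j _ => ?_
    rw [Finset.sum_div]
    refine Finset.sum_congr rfl fun i _ => ?_
    rw [hPu, hQu]
    have := (hs i).ne'
    field_simp
  have norm_P : ∑ x : Fin d × Fin d, P.mulVec u x ^ 2 = 1 := by
    rw [Fintype.sum_prod_type, ← hu]
    refine Finset.sum_congr rfl fun i _ => ?_
    simp_rw [hPu, mul_pow, div_pow, ← Finset.sum_mul, ← Finset.sum_div]
    rw [hs_sq, div_self (Real.sqrt_pos.mp (hs i)).ne', one_mul]
  have norm_Q : ∑ x : Fin d × Fin d, Q.mulVec u x ^ 2 = 1 := by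
    rw [Fintype.sum_prod_type]
    simp_rw [hQu, mul_pow, div_pow, ← Finset.mul_sum, hu, mul_one, ← Finset.sum_div, hs_sq, hF_sq]
    rw [Finset.sum_comm, div_self hF.ne']
  refine ⟨inner_PQ, ?_, ?_⟩
  · have expand : ∀ x, ((P.mulVec u x - Q.mulVec u x) / 2) ^ 2 =
        (P.mulVec u x ^ 2 + Q.mulVec u x ^ 2 - 2 * (P.mulVec u x * Q.mulVec u x)) / 4 :=
      fun x => by ring
    simp_rw [expand]
    rw [← Finset.sum_div, Finset.sum_sub_distrib, Finset.sum_add_distrib, ← Finset.mul_sum,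
      norm_P, norm_Q, inner_PQ]
    ring
  · have expand : ∀ x, ((P.mulVec u x + Q.mulVec u x) / 2) ^ 2 =
        (P.mulVec u x ^ 2 + Q.mulVec u x ^ 2 + 2 * (P.mulVec u x * Q.mulVec u x)) / 4 :=
      fun x => by ring
    simp_rw [expand]
    rw [← Finset.sum_div, Finset.sum_add_distrib, Finset.sum_add_distrib, ← Finset.mul_sum,
      norm_P, norm_Q, inner_PQ]
    ring
end

section
/- Let s, s₁, …, s_m be unit vectors in a real inner product space with s₁, …, s_m linearly independent, let C = (⟨s_i, s_j⟩)_{i,j} be the (invertible, positive definite) Gram matrix of s₁, …, s_m, let b = (⟨s_i, s⟩)_i ∈ ℝ^m, and set y = C⁻¹b. Assume s ∉ span{s₁, …, s_m}, and let Z = ‖s − Σ_{i=1}^m y_i s_i‖ > 0 and t = (s − Σ_i y_i s_i)/Z. Let ỹ ∈ ℝ^m be arbitrary, Δy = ỹ − y, and w = s − Σ_i ỹ_i s_i. Then ‖w‖² = Z² + ΔyᵀCΔy > 0, ⟨t, w⟩ = Z, and ‖t − w/‖w‖‖ ≤ √‖C‖ · ‖Δy‖ / Z, where ‖C‖ is the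 operator norm of C. -/
open scoped BigOperators RealInnerProductSpace

/-- Subtracting the combination given by the inverse Gram matrix leaves a vector orthogonal to
the family. -/
theorem inner_sub_sum_gram_inv_mulVec_eq_zero {ι E : Type*} [Fintype ι] [DecidableEq ι]
    [NormedAddCommGroup E] [InnerProductSpace ℝ E] {v : ι → E} (hv : LinearIndependent ℝ v)
    (x : E) (i : ι) :
    ⟪v i, x - ∑ j, ((Matrix.gram ℝ v)⁻¹.mulVec fun k => ⟪v k, x⟫) j • v j⟫ = 0 := by
  set y := (Matrix.gram ℝ v)⁻¹.mulVec fun k => ⟪v k, x⟫ with hy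
  have hdet : IsUnit (Matrix.gram ℝ v).det :=
    isUnit_iff_ne_zero.mpr (Matrix.det_gram_ne_zero_iff_linearIndependent.mpr hv)
  have h : (Matrix.gram ℝ v).mulVec y = fun k => ⟪v k, x⟫ := by
    rw [hy, Matrix.mulVec_mulVec, Matrix.mul_nonsing_inv _ hdet, Matrix.one_mulVec]
  have hi := congrFun h i
  simp only [Matrix.mulVec, dotProduct, Matrix.gram_apply] at hi
  simp only [inner_sub_right, inner_sum, real_inner_smul_right, ← hi]
  simp only [mul_comm, sub_self]

/-- A quadratic form is bounded by the operator norm of its matrix. -/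
theorem Matrix.dotProduct_mulVec_le_norm_toEuclideanCLM {ι : Type*} [Fintype ι] [DecidableEq ι]
    (A : Matrix ι ι ℝ) (x : ι → ℝ) :
    x ⬝ᵥ A.mulVec x ≤ ‖Matrix.toEuclideanCLM (𝕜 := ℝ) A‖ * ∑ i, x i ^ 2 := by
  have h := Matrix.inner_toEuclideanCLM A (WithLp.toLp 2 x) (WithLp.toLp 2 x)
  rw [← EuclideanSpace.real_norm_sq_eq (WithLp.toLp 2 x), ← h]
  calc _ ≤ ‖WithLp.toLp 2 x‖ * ‖Matrix.toEuclideanCLM (𝕜 := ℝ) A (WithLp.toLp 2 x)‖ :=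
        real_inner_le_norm _ _
    _ ≤ ‖WithLp.toLp 2 x‖ * (‖Matrix.toEuclideanCLM (𝕜 := ℝ) A‖ * ‖WithLp.toLp 2 x‖) := by
        gcongr
        exact ContinuousLinearMap.le_opNorm _ _
    _ = _ := by ring

/-- Perturbing a nonzero vector `r` by an orthogonal vector `d` moves its normalization by at most
`‖d‖ / ‖r‖`. -/
theorem norm_normalize_sub_normalize_le_of_inner_eq_zero {E : Type*} [NormedAddCommGroup E]
    [InnerProductSpace ℝ E] {r d : E} (hr : r ≠ 0) (h : ⟪r, d⟫ = 0) :
    ‖‖r‖⁻¹ • r - ‖r - d‖⁻¹ • (r - d)‖ ≤ ‖d‖ / ‖r‖ := by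
  have hZ : 0 < ‖r‖ := norm_pos_iff.mpr hr
  have hsq : ‖r - d‖ ^ 2 = ‖r‖ ^ 2 + ‖d‖ ^ 2 := by rw [norm_sub_sq_real, h]; ring
  have hrw : ‖r‖ ≤ ‖r - d‖ :=
    le_of_sq_le_sq (by nlinarith [sq_nonneg ‖d‖]) (norm_nonneg _)
  have hinner : ⟪r, r - d⟫ = ‖r‖ ^ 2 := by
    rw [inner_sub_right, h, real_inner_self_eq_norm_sq, sub_zero]
  have hW : 0 < ‖r - d‖ := hZ.trans_le hrw
  refine le_of_sq_le_sq ?_ (by positivity)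
  rw [norm_sub_sq_real, real_inner_smul_left, real_inner_smul_right, hinner, norm_smul, norm_smul,
    norm_inv, norm_inv, norm_norm, norm_norm, inv_mul_cancel₀ hZ.ne', inv_mul_cancel₀ hW.ne',
    div_pow, eq_sub_of_add_eq' hsq.symm, le_div_iff₀ (by positivity)]
  generalize ‖r - d‖ = W at *
  generalize ‖r‖ = Z at *
  have hexp : (1 ^ 2 - 2 * (Z⁻¹ * (W⁻¹ * Z ^ 2)) + 1 ^ 2) * Z ^ 2 = 2 * (W - Z) * Z ^ 2 / W := by
    field_simp
    ring
  rw [hexp, div_le_iff₀ hW]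
  nlinarith [mul_nonneg (sub_nonneg.mpr hrw) (by nlinarith : 0 ≤ (W + Z) * W - 2 * Z ^ 2)]

/-- Let `s, s₁, …, s_m` be unit vectors with `s₁, …, s_m` linearly independent,
`C` their Gram matrix, `b` the vector of inner products `⟨sᵢ, s⟩`, `y = C⁻¹b`,
`s ∉ span{sᵢ}`, `Z = ‖s − ∑ yᵢ sᵢ‖`, `t = (s − ∑ yᵢ sᵢ)/Z`.  For arbitrary `ỹ`,
with `Δy = ỹ − y` and `w = s − ∑ ỹᵢ sᵢ`:  `‖w‖² = Z² + ΔyᵀCΔy > 0`, `⟨t, w⟩ = Z`,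
and `‖t − w/‖w‖‖ ≤ √‖C‖·‖Δy‖/Z`. -/
theorem perturbed_gram_schmidt_overlap {E : Type*} [NormedAddCommGroup E]
    [InnerProductSpace ℝ E] {m : ℕ} (s : E) (sv : Fin m → E)
    (hs : ‖s‖ = 1) (hsv : ∀ i, ‖sv i‖ = 1)
    (hindep : LinearIndependent ℝ sv)
    (C : Matrix (Fin m) (Fin m) ℝ) (hC : ∀ i j, C i j = ⟪sv i, sv j⟫)
    (b : Fin m → ℝ) (hb : ∀ i, b i = ⟪sv i, s⟫)
    (y : Fin m → ℝ) (hy : y = C⁻¹.mulVec b)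
    (hspan : s ∉ Submodule.span ℝ (Set.range sv))
    (Z : ℝ) (hZ : Z = ‖s - ∑ i, y i • sv i‖)
    (t : E) (ht : t = Z⁻¹ • (s - ∑ i, y i • sv i))
    (ytil : Fin m → ℝ) (Δy : Fin m → ℝ) (hΔy : Δy = ytil - y)
    (w : E) (hw : w = s - ∑ i, ytil i • sv i) :
    (‖w‖ ^ 2 = Z ^ 2 + ∑ i, ∑ j, Δy i * C i j * Δy j) ∧ 0 < ‖w‖ ^ 2 ∧
    ⟪t, w⟫ = Z ∧
    ‖t - ‖w‖⁻¹ • w‖ ≤ Real.sqrt ‖Matrix.toEuclideanCLM (𝕜 := ℝ) C‖ *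
      Real.sqrt (∑ i, Δy i ^ 2) / Z := by
  obtain rfl : C = Matrix.gram ℝ sv := Matrix.ext hC
  obtain rfl : b = fun i => ⟪sv i, s⟫ := funext hb
  set r := s - ∑ i, y i • sv i with hr
  set d := ∑ i, Δy i • sv i with hd
  have horth (i : Fin m) : ⟪sv i, r⟫ = 0 := by
    rw [hr, hy]
    exact inner_sub_sum_gram_inv_mulVec_eq_zero hindep s i
  have hrd : ⟪r, d⟫ = 0 := by
    rw [real_inner_comm, hd, sum_inner]
    simp [real_inner_smul_left, horth]
  have hw' : w = r - d := by
    simp [hw, hr, hd, hΔy, sub_smul, Finset.sum_sub_distrib]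
  have hr0 : r ≠ 0 := fun h => hspan <| by
    rw [sub_eq_zero.mp h]
    exact Submodule.sum_mem _ fun i _ =>
      Submodule.smul_mem _ _ (Submodule.subset_span (Set.mem_range_self i))
  have hZpos : 0 < Z := hZ ▸ norm_pos_iff.mpr hr0
  have hquad : Δy ⬝ᵥ (Matrix.gram ℝ sv).mulVec Δy = ‖d‖ ^ 2 := by
    simpa using Matrix.star_dotProduct_gram_mulVec (𝕜 := ℝ) sv Δy Δy
  have hsum : ∑ i, ∑ j, Δy i * Matrix.gram ℝ sv i j * Δy j = ‖d‖ ^ 2 := by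
    simp only [← hquad, dotProduct, Matrix.mulVec, Finset.mul_sum, mul_assoc]
  have hsq : ‖w‖ ^ 2 = Z ^ 2 + ‖d‖ ^ 2 := by rw [hw', norm_sub_sq_real, hrd, hZ]; ring
  refine ⟨by rw [hsum, hsq], by rw [hsq]; positivity, ?_, ?_⟩
  · rw [ht, hw', real_inner_smul_left, inner_sub_right, hrd, real_inner_self_eq_norm_sq, ← hZ]
    field_simp
    ring
  · have hdle : ‖d‖ ≤ Real.sqrt ‖Matrix.toEuclideanCLM (𝕜 := ℝ) (Matrix.gram ℝ sv)‖ *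
        Real.sqrt (∑ i, Δy i ^ 2) := by
      rw [← Real.sqrt_mul (norm_nonneg _)]
      refine Real.le_sqrt_of_sq_le ?_
      rw [← hquad]
      exact Matrix.dotProduct_mulVec_le_norm_toEuclideanCLM _ _
    rw [ht, hw', hZ]
    exact (norm_normalize_sub_normalize_le_of_inner_eq_zero hr0 hrd).trans (by gcongr)
end

section
/- Let H be a real symmetric d×d matrix with eigenvalues λ₁, …, λ_d ordered so that λ₁² ≥ λ₂² ≥ … ≥ λ_d². Then for any orthonormal vectors t₁, …, t_l in ℝ^d (l ≤ d), Σ_{m=1}^l ‖H t_m‖² ≤ Σ_{i=1}^l λ_i². Consequently, writing h_j for the columns of H, Σ_{j=1}^d ‖h_j − Σ_{m=1}^l ⟨t_m, h_j⟩ t_m‖² ≥ Σ_{i=l+1}^d λ_i². -/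
open scoped BigOperators

namespace Matrix

variable {m n : Type*} [Fintype m] [Fintype n]

theorem sum_sq_eq_trace_mul_transpose (A : Matrix m n ℝ) :
    ∑ i, ∑ j, A i j ^ 2 = (A * Aᵀ).trace := by
  simp [trace, mul_apply, sq]

theorem sum_sq_col_le_one_of_mul_transpose_eq_one [DecidableEq m] {W : Matrix m n ℝ}
    (hW : W * Wᵀ = 1) (k : n) : ∑ i, W i k ^ 2 ≤ 1 := by
  set P := Wᵀ * W with hP
  have hPP : P * Pᵀ = P := by
    rw [hP, transpose_mul, transpose_transpose, Matrix.mul_assoc, ← Matrix.mul_assoc W, hW,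
      Matrix.one_mul]
  have hkk : P k k = ∑ i, W i k ^ 2 := by simp [hP, mul_apply, sq]
  have hsum : ∑ j, P k j ^ 2 = P k k := by
    conv_rhs => rw [← hPP]
    simp [mul_apply, sq]
  have hle : P k k ^ 2 ≤ ∑ j, P k j ^ 2 :=
    Finset.single_le_sum (f := fun j => P k j ^ 2) (fun j _ => sq_nonneg _) (Finset.mem_univ k)
  rw [← hkk]
  nlinarith

theorem sum_sq_sub_projection [DecidableEq m] {p : Type*} [Fintype p] {T : Matrix m n ℝ}
    (hT : T * Tᵀ = 1) (A : Matrix n p ℝ) :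
    ∑ i, ∑ j, (A - Tᵀ * (T * A)) i j ^ 2
      = ∑ i, ∑ j, A i j ^ 2 - ∑ i, ∑ j, (T * A) i j ^ 2 := by
  simp only [sum_sq_eq_trace_mul_transpose]
  set B := T * A with hB
  have h1 : (A * (Bᵀ * T)).trace = (B * Bᵀ).trace := by
    rw [← Matrix.mul_assoc, trace_mul_comm, ← Matrix.mul_assoc]
  have h2 : (Tᵀ * B * Aᵀ).trace = (B * Bᵀ).trace := by
    rw [Matrix.mul_assoc, trace_mul_comm, Matrix.mul_assoc, hB, transpose_mul]
  have h3 : (Tᵀ * B * (Bᵀ * T)).trace = (B * Bᵀ).trace := by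
    rw [← Matrix.mul_assoc, trace_mul_comm, ← Matrix.mul_assoc, ← Matrix.mul_assoc, hT,
      Matrix.one_mul]
  rw [transpose_sub, transpose_mul, transpose_transpose, Matrix.sub_mul, Matrix.mul_sub,
    Matrix.mul_sub, trace_sub, trace_sub, trace_sub, h1, h2, h3]
  ring

theorem sum_sq_mul_diagonal_mul [DecidableEq n] {U : Matrix n n ℝ} (hU : U * Uᵀ = 1)
    (T : Matrix m n ℝ) (v : n → ℝ) :
    ∑ i, ∑ j, (T * (Uᵀ * diagonal v * U)) i j ^ 2
      = ∑ k, v k ^ 2 * ∑ i, (T * Uᵀ) i k ^ 2 := by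
  have h : T * (Uᵀ * diagonal v * U) * (T * (Uᵀ * diagonal v * U))ᵀ
      = (T * Uᵀ * diagonal v) * (T * Uᵀ * diagonal v)ᵀ := by
    have e : T * (Uᵀ * diagonal v * U) = (T * Uᵀ * diagonal v) * U := by
      simp only [Matrix.mul_assoc]
    rw [e, transpose_mul _ U, Matrix.mul_assoc, ← Matrix.mul_assoc U, hU, Matrix.one_mul]
  rw [sum_sq_eq_trace_mul_transpose, h, ← sum_sq_eq_trace_mul_transpose, Finset.sum_comm]
  refine Finset.sum_congr rfl fun k _ => ?_
  rw [Finset.mul_sum]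
  refine Finset.sum_congr rfl fun i _ => ?_
  rw [mul_diagonal]
  ring

end Matrix

theorem Fin.sum_filter_val_lt {M : Type*} [AddCommMonoid M] {d l : ℕ} (hl : l ≤ d)
    (a : Fin d → M) :
    ∑ i ∈ Finset.univ.filter (fun i : Fin d => (i : ℕ) < l), a i
      = ∑ i : Fin l, a (Fin.castLE hl i) := by
  symm
  refine Finset.sum_bij (fun i _ => Fin.castLE hl i) ?_ ?_ ?_ ?_
  · intro i _
    simp
  · intro i _ j _ h
    exact Fin.castLE_injective hl h
  · intro i hi
    exact ⟨⟨i, (Finset.mem_filter.1 hi).2⟩, Finset.mem_univ _, rfl⟩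
  · intro i _
    rfl

theorem Antitone.sum_mul_le_sum_castLE {d l : ℕ} (hl : l ≤ d) {a w : Fin d → ℝ}
    (ha : Antitone a) (hw0 : ∀ k, 0 ≤ w k) (hw1 : ∀ k, w k ≤ 1) (hw : ∑ k, w k = l) :
    ∑ k, a k * w k ≤ ∑ i : Fin l, a (Fin.castLE hl i) := by
  obtain ⟨c, hc1, hc2⟩ : ∃ c, (∀ k : Fin d, (k : ℕ) < l → c ≤ a k) ∧
      ∀ k : Fin d, l ≤ (k : ℕ) → a k ≤ c := by
    by_cases h : l < d
    · exact ⟨a ⟨l, h⟩, fun k hk => ha (Fin.le_def.2 hk.le), fun k hk => ha (Fin.le_def.2 hk)⟩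
    · rcases Nat.eq_zero_or_pos d with rfl | hd
      · exact ⟨0, fun k => k.elim0, fun k => k.elim0⟩
      · exact ⟨a ⟨d - 1, by omega⟩, fun k _ => ha (Fin.le_def.2 (by simp; omega)),
          fun k hk => absurd k.isLt (by omega)⟩
  have hone : ∑ k : Fin d, (if (k : ℕ) < l then (1 : ℝ) else 0) = l := by
    rw [← Finset.sum_filter, Fin.sum_filter_val_lt hl]
    simp
  calc ∑ k, a k * w k
      ≤ ∑ k : Fin d, ((if (k : ℕ) < l then a k else 0)
          + c * (w k - if (k : ℕ) < l then 1 else 0)) := by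
        refine Finset.sum_le_sum fun k _ => ?_
        split_ifs with h
        · nlinarith [hc1 k h, hw1 k]
        · nlinarith [hc2 k (not_lt.1 h), hw0 k]
    _ = ∑ i : Fin l, a (Fin.castLE hl i) := by
        rw [Finset.sum_add_distrib, ← Finset.mul_sum, Finset.sum_sub_distrib, hw, hone,
          ← Finset.sum_filter, Fin.sum_filter_val_lt hl]
        ring

/-- Let `H` be a real symmetric `d×d` matrix with eigenvalues `λ₁, …, λ_d` (given by a
spectral decomposition with orthonormal eigenvectors) ordered so that
`λ₁² ≥ λ₂² ≥ … ≥ λ_d²`.  Then for any orthonormal `t₁, …, t_l` in `ℝ^d` (`l ≤ d`),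
`∑ₘ ‖H tₘ‖² ≤ ∑_{i=1}^l λᵢ²`, and consequently
`∑ⱼ ‖hⱼ − ∑ₘ ⟨tₘ, hⱼ⟩ tₘ‖² ≥ ∑_{i=l+1}^d λᵢ²`. -/
theorem residual_norm_lower_bound {d l : ℕ} (hl : l ≤ d)
    (H : Matrix (Fin d) (Fin d) ℝ) (hsymm : H.IsSymm)
    (lam : Fin d → ℝ) (u : Fin d → (Fin d → ℝ))
    (huorth : ∀ k k', ∑ i, u k i * u k' i = if k = k' then (1 : ℝ) else 0)
    (hH : H = ∑ k, lam k • Matrix.vecMulVec (u k) (u k))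
    (hord : ∀ i j : Fin d, i ≤ j → lam j ^ 2 ≤ lam i ^ 2)
    (t : Fin l → (Fin d → ℝ))
    (horth : ∀ m n, ∑ a, t m a * t n a = if m = n then (1 : ℝ) else 0) :
    (∑ m, ∑ a, (H.mulVec (t m) a) ^ 2 ≤ ∑ i : Fin l, lam (Fin.castLE hl i) ^ 2) ∧
    (∑ i ∈ Finset.univ.filter (fun i : Fin d => l ≤ (i : ℕ)), lam i ^ 2)
      ≤ ∑ j, ∑ a, (H a j - ∑ m, (∑ b, t m b * H b j) * t m a) ^ 2 := by
  set U : Matrix (Fin d) (Fin d) ℝ := Matrix.of u with hUdef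
  set T : Matrix (Fin l) (Fin d) ℝ := Matrix.of t with hTdef
  have hU : U * U.transpose = 1 := by
    ext i j
    simp [hUdef, Matrix.mul_apply, huorth, Matrix.one_apply]
  have hT : T * T.transpose = 1 := by
    ext i j
    simp [hTdef, Matrix.mul_apply, horth, Matrix.one_apply]
  have hU' : U.transpose * U = 1 := mul_eq_one_comm.1 hU
  have hHU : H = U.transpose * Matrix.diagonal lam * U := by
    rw [hH]
    ext i j
    rw [Matrix.sum_apply, Matrix.mul_apply]
    refine Finset.sum_congr rfl fun k _ => ?_
    simp only [Matrix.smul_apply, Matrix.vecMulVec_apply, Matrix.mul_diagonal, smul_eq_mul,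
      Matrix.transpose_apply, hUdef, Matrix.of_apply]
    ring
  have hWW : T * U.transpose * (T * U.transpose).transpose = 1 := by
    rw [Matrix.transpose_mul, Matrix.transpose_transpose, Matrix.mul_assoc,
      ← Matrix.mul_assoc U.transpose, hU', Matrix.one_mul, hT]
  have hTH : ∑ m, ∑ a, (T * H) m a ^ 2 ≤ ∑ i : Fin l, lam (Fin.castLE hl i) ^ 2 := by
    rw [hHU, Matrix.sum_sq_mul_diagonal_mul hU]
    refine Antitone.sum_mul_le_sum_castLE hl (a := fun k => lam k ^ 2)
      (fun i j hij => hord i j hij) (fun k => Finset.sum_nonneg fun i _ => sq_nonneg _)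
      (Matrix.sum_sq_col_le_one_of_mul_transpose_eq_one hWW) ?_
    rw [Finset.sum_comm, Matrix.sum_sq_eq_trace_mul_transpose, hWW]
    simp
  have hHH : ∑ i, ∑ j, H i j ^ 2 = ∑ k, lam k ^ 2 := by
    have h := Matrix.sum_sq_mul_diagonal_mul hU U lam
    rw [← hHU, hU, Matrix.sum_sq_eq_trace_mul_transpose, Matrix.transpose_mul,
      Matrix.trace_mul_comm, Matrix.mul_assoc, ← Matrix.mul_assoc U.transpose, hU',
      Matrix.one_mul, Matrix.trace_mul_comm, ← Matrix.sum_sq_eq_trace_mul_transpose] at h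
    simpa [Matrix.one_apply] using h
  have hmulVec : ∀ m a, H.mulVec (t m) a = (T * H) m a := by
    intro m a
    simp only [Matrix.mulVec, dotProduct, Matrix.mul_apply, hTdef, Matrix.of_apply]
    refine Finset.sum_congr rfl fun b _ => ?_
    rw [hsymm.apply b a, mul_comm]
  have hres : ∀ a j, H a j - ∑ m, (∑ b, t m b * H b j) * t m a
      = (H - T.transpose * (T * H)) a j := by
    intro a j
    rw [Matrix.sub_apply, Matrix.mul_apply]
    simp [hTdef, Matrix.mul_apply, mul_comm]
  simp only [hmulVec, hres]
  refine ⟨hTH, ?_⟩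
  rw [Finset.sum_comm, Matrix.sum_sq_sub_projection hT, hHH]
  have hsplit := Finset.sum_filter_add_sum_filter_not Finset.univ
    (fun i : Fin d => (i : ℕ) < l) (fun i => lam i ^ 2)
  rw [Fin.sum_filter_val_lt hl] at hsplit
  simp only [not_lt] at hsplit
  linarith
end

section
/- Let H be a real symmetric d×d matrix of rank r whose nonzero eigenvalues (with multiplicity) are λ₁, …, λ_r. Let g : {1, …, r} → {1, …, d} be an injective index map. Let C be the r×r matrix with entries C_{jk} = ⟨h_{g(j)}, h_{g(k)}⟩ (equivalently C_{jk} = (H²)_{g(j), g(k)}), and let H' be the r×r matrix with entries H'_{jk} = H_{g(j), g(k)}. Then det C = (∏_{i=1}^r λ_i) · det H'. -/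
open scoped BigOperators
open scoped Matrix

/-- Let `H` be a real symmetric `d×d` matrix of rank `r` with nonzero eigenvalues
`λ₁, …, λ_r` (spectral decomposition with orthonormal `u₁, …, u_r`), and let
`g : [r] → [d]` be injective.  Let `C` be the `r×r` matrix with entries
`C_{jk} = ⟨h_{g(j)}, h_{g(k)}⟩ = (H²)_{g(j),g(k)}` and `H'` the `r×r` matrix with
entries `H'_{jk} = H_{g(j),g(k)}`.  Then `det C = (∏ᵢ λᵢ) · det H'`. -/
theorem det_gram_eq_prod_eigen_mul_det_submatrix {d r : ℕ}
    (H : Matrix (Fin d) (Fin d) ℝ) (hsymm : H.IsSymm) (hrank : H.rank = r)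
    (lam : Fin r → ℝ) (hlam : ∀ k, lam k ≠ 0)
    (u : Fin r → (Fin d → ℝ))
    (huorth : ∀ k k', ∑ i, u k i * u k' i = if k = k' then (1 : ℝ) else 0)
    (hH : H = ∑ k, lam k • Matrix.vecMulVec (u k) (u k))
    (g : Fin r → Fin d) (hg : Function.Injective g)
    (C : Matrix (Fin r) (Fin r) ℝ)
    (hC : ∀ j k, C j k = ∑ a, H a (g j) * H a (g k))
    (H' : Matrix (Fin r) (Fin r) ℝ)
    (hH' : ∀ j k, H' j k = H (g j) (g k)) :
    C.det = (∏ i, lam i) * H'.det := by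
  set U : Matrix (Fin r) (Fin d) ℝ := Matrix.of u
  set D : Matrix (Fin r) (Fin r) ℝ := Matrix.diagonal lam
  set V : Matrix (Fin r) (Fin r) ℝ := Uᵀ.submatrix g id
  have hU : U * Uᵀ = 1 := by
    ext k k'
    simpa [U, Matrix.mul_apply, Matrix.one_apply] using huorth k k'
  have hspec : H = Uᵀ * D * U := by
    ext i j
    rw [hH, Matrix.sum_apply, Matrix.mul_apply]
    refine Finset.sum_congr rfl fun k _ => ?_
    simp only [U, D, Matrix.smul_apply, Matrix.vecMulVec_apply, smul_eq_mul,
      Matrix.mul_diagonal, Matrix.transpose_apply, Matrix.of_apply]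
    ring
  have hsq : H * H = Uᵀ * (D * D) * U := by
    calc H * H = Uᵀ * D * (U * Uᵀ) * D * U := by
          rw [hspec]; simp only [Matrix.mul_assoc]
      _ = Uᵀ * (D * D) * U := by rw [hU, Matrix.mul_one]; simp only [Matrix.mul_assoc]
  have hC_eq : C = V * (D * D) * Vᵀ := by
    ext j k
    have hjk : C j k = (H * H) (g j) (g k) := by
      simp only [hC, Matrix.mul_apply, hsymm.apply]
    rw [hjk, hsq]
    rfl
  have hH'_eq : H' = V * D * Vᵀ := by
    ext j k
    rw [hH', hspec]
    rfl
  rw [hC_eq, hH'_eq]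
  simp only [Matrix.det_mul, D, Matrix.det_diagonal]
  ring
end

section
/- Let H be a real symmetric d×d matrix of rank r, let g : {1, …, r} → {1, …, d} be an injective index map, and let H' be the r×r matrix with entries H'_{jk} = H_{g(j), g(k)}. Then the columns h_{g(1)}, …, h_{g(r)} of H are linearly independent if and only if det H' ≠ 0. -/
open scoped BigOperators

/-- Let `H` be a real symmetric `d×d` matrix of rank `r`, `g : [r] → [d]` injective,
and `H'` the `r×r` matrix with entries `H'_{jk} = H_{g(j),g(k)}`.  Then the columns
`h_{g(1)}, …, h_{g(r)}` of `H` are linearly independent iff `det H' ≠ 0`. -/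
theorem columns_linearIndependent_iff_det_submatrix_ne_zero {d r : ℕ}
    (H : Matrix (Fin d) (Fin d) ℝ) (hsymm : H.IsSymm) (hrank : H.rank = r)
    (g : Fin r → Fin d) (hg : Function.Injective g) :
    LinearIndependent ℝ (fun i : Fin r => (fun a => H a (g i) : Fin d → ℝ)) ↔
      (Matrix.of fun j k : Fin r => H (g j) (g k)).det ≠ 0 := by
  refine ⟨fun hli hdet => ?_, fun hdet => ?_⟩
  · obtain ⟨x, hx, hxM⟩ := Matrix.exists_vecMul_eq_zero_iff.mpr hdet
    have hspan : Submodule.span ℝ (Set.range fun i : Fin r => H.col (g i)) =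
        Submodule.span ℝ (Set.range H.col) := by
      refine Submodule.eq_of_le_of_finrank_eq (Submodule.span_mono ?_) ?_
      · rintro _ ⟨i, rfl⟩
        exact ⟨g i, rfl⟩
      · rw [← H.rank_eq_finrank_span_cols, hrank]
        exact (finrank_span_eq_card hli).trans (Fintype.card_fin r)
    let φ : (Fin d → ℝ) →ₗ[ℝ] ℝ := ∑ k, x k • LinearMap.proj (g k)
    have hφ (v : Fin d → ℝ) : φ v = ∑ k, x k * v (g k) := by simp [φ]
    have hle : Submodule.span ℝ (Set.range H.col) ≤ LinearMap.ker φ := by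
      rw [← hspan, Submodule.span_le]
      rintro _ ⟨j, rfl⟩
      exact (hφ _).trans (congrFun hxM j)
    refine hx (funext (Fintype.linearIndependent_iff.mp hli x (funext fun i => ?_)))
    have hi : φ (H.col i) = 0 := hle (Submodule.subset_span ⟨i, rfl⟩)
    rw [hφ] at hi
    simpa [Matrix.col_apply, hsymm.apply] using hi
  · exact LinearIndependent.of_comp (LinearMap.funLeft ℝ ℝ g)
      (Matrix.linearIndependent_cols_of_det_ne_zero hdet)
end

section
/- Let s₁, …, s_r be linearly independent unit vectors in ℝ^d, let C be their (invertible, positive definite) Gram matrix C_{jk} = ⟨s_j, s_k⟩, let u be a unit vector in span{s₁, …, s_r}, let b ∈ ℝ^r with b_j = ⟨u, s_j⟩, and let x = C⁻¹b, so that u = Σ_{j=1}^r x_j s_j. Let ε ∈ (0,1], set ε₁ = ε/(6r²‖C⁻¹‖²) and ε₂ = ε/(6r‖C⁻¹‖), and suppose C̃ is a real r×r matrix and b̃ ∈ ℝ^r with |C̃_{jk} − C_{jk}| ≤ ε₁ and |b̃_j − b_j| ≤ ε₂ for all j, k. Then C̃ is invertible and, with x̃ = C̃⁻¹b̃, the vector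 ũ = Σ_{j=1}^r x̃_j s_j satisfies ‖ũ − u‖ ≤ ε/2. -/
open scoped BigOperators

open WithLp in
theorem norm_toLp_le_of_abs_le {ι : Type*} [Fintype ι] {v : ι → ℝ} {δ : ℝ} (hδ : 0 ≤ δ)
    (hv : ∀ i, |v i| ≤ δ) : ‖toLp 2 v‖ ≤ √(Fintype.card ι) * δ := by
  rw [EuclideanSpace.norm_eq]
  refine Real.sqrt_le_iff.2 ⟨by positivity, ?_⟩
  rw [mul_pow, Real.sq_sqrt (Nat.cast_nonneg _)]
  calc ∑ i, ‖toLp 2 v i‖ ^ 2 ≤ ∑ _i : ι, δ ^ 2 :=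
        Finset.sum_le_sum fun i _ => pow_le_pow_left₀ (norm_nonneg _) (hv i) 2
    _ = Fintype.card ι * δ ^ 2 := by simp

open WithLp in
theorem sum_abs_le_sqrt_card_mul_norm_toLp {ι : Type*} [Fintype ι] (v : ι → ℝ) :
    ∑ i, |v i| ≤ √(Fintype.card ι) * ‖toLp 2 v‖ := by
  rw [EuclideanSpace.norm_eq, ← Real.sqrt_mul (Nat.cast_nonneg _)]
  refine Real.le_sqrt_of_sq_le ?_
  simpa using sq_sum_le_card_mul_sum_sq (s := Finset.univ) (f := fun i => |v i|)

open WithLp in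
theorem norm_toLp_mulVec_le_of_abs_le {ι : Type*} [Fintype ι] {A : Matrix ι ι ℝ} {δ : ℝ}
    (hδ : 0 ≤ δ) (hA : ∀ i j, |A i j| ≤ δ) (v : ι → ℝ) :
    ‖toLp 2 (A.mulVec v)‖ ≤ Fintype.card ι * δ * ‖toLp 2 v‖ := by
  have hrow : ∀ i, |A.mulVec v i| ≤ δ * (√(Fintype.card ι) * ‖toLp 2 v‖) := fun i => by
    calc |A.mulVec v i| ≤ ∑ j, |A i j * v j| := Finset.abs_sum_le_sum_abs _ _
      _ ≤ ∑ j, δ * |v j| := Finset.sum_le_sum fun j _ => by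
          rw [abs_mul]; exact mul_le_mul_of_nonneg_right (hA i j) (abs_nonneg _)
      _ = δ * ∑ j, |v j| := (Finset.mul_sum _ _ _).symm
      _ ≤ _ := mul_le_mul_of_nonneg_left (sum_abs_le_sqrt_card_mul_norm_toLp v) hδ
  calc ‖toLp 2 (A.mulVec v)‖
      ≤ √(Fintype.card ι) * (δ * (√(Fintype.card ι) * ‖toLp 2 v‖)) :=
        norm_toLp_le_of_abs_le (by positivity) hrow
    _ = (√(Fintype.card ι) * √(Fintype.card ι)) * δ * ‖toLp 2 v‖ := by ring
    _ = _ := by rw [Real.mul_self_sqrt (Nat.cast_nonneg _)]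

open WithLp in
theorem norm_toLp_le_norm_inv_mul_norm_mulVec {ι : Type*} [Fintype ι] [DecidableEq ι]
    {A : Matrix ι ι ℝ} (hA : IsUnit A) (v : ι → ℝ) :
    ‖toLp 2 v‖ ≤ ‖Matrix.toEuclideanCLM (𝕜 := ℝ) A⁻¹‖ * ‖toLp 2 (A.mulVec v)‖ := by
  have h := (Matrix.toEuclideanCLM (𝕜 := ℝ) A⁻¹).le_opNorm (toLp 2 (A.mulVec v))
  rwa [Matrix.toEuclideanCLM_toLp, Matrix.mulVec_mulVec,
    Matrix.nonsing_inv_mul _ ((Matrix.isUnit_iff_isUnit_det _).1 hA), Matrix.one_mulVec] at h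

theorem abs_sum_mul_le_one {ι : Type*} [Fintype ι] {v w : ι → ℝ} (hv : ∑ i, v i ^ 2 = 1)
    (hw : ∑ i, w i ^ 2 = 1) : |∑ i, v i * w i| ≤ 1 := by
  have h := Finset.sum_mul_sq_le_sq_mul_sq Finset.univ v w
  rw [hv, hw] at h
  exact abs_le_one_iff_mul_self_le_one.2 (by nlinarith)

theorem sqrt_sum_sq_sum_mul_le {ι κ : Type*} [Fintype ι] [Fintype κ] {s : ι → κ → ℝ}
    (hs : ∀ i, ∑ a, s i a ^ 2 = 1) (w : ι → ℝ) :
    √(∑ a, (∑ j, w j * s j a) ^ 2) ≤ ∑ j, |w j| := by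
  have h := norm_sum_le Finset.univ fun j => w j • WithLp.toLp 2 (s j)
  simpa [EuclideanSpace.norm_eq, norm_smul, hs] using h

theorem isUnit_of_linearIndependent_of_apply_eq_sum {ι κ : Type*} [Fintype ι] [DecidableEq ι]
    [Fintype κ] {s : ι → κ → ℝ} (hs : LinearIndependent ℝ s) {C : Matrix ι ι ℝ}
    (hC : ∀ j k, C j k = ∑ a, s j a * s k a) : IsUnit C := by
  have hCs : C = Matrix.of s * (Matrix.of s).conjTranspose := by
    ext j k; simp [hC, Matrix.mul_apply]
  rw [hCs]
  exact (Matrix.PosDef.mul_conjTranspose_self _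
    (Matrix.vecMul_injective_iff.2 hs)).isUnit

/-- Coordinate estimation: let `s₁, …, s_r` be linearly independent unit vectors in
`ℝ^d` with Gram matrix `C`, `u` a unit vector in their span, `b_j = ⟨u, s_j⟩` and
`x = C⁻¹b` (so `u = ∑ x_j s_j`).  If `C̃` and `b̃` approximate `C` and `b` entrywise
within `ε₁ = ε/(6r²‖C⁻¹‖²)` and `ε₂ = ε/(6r‖C⁻¹‖)` respectively (`ε ∈ (0,1]`,
operator norms), then `C̃` is invertible and `ũ = ∑ (C̃⁻¹b̃)_j s_j` satisfies
`‖ũ − u‖ ≤ ε/2`. -/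
theorem coordinate_estimation {d r : ℕ} (s : Fin r → (Fin d → ℝ))
    (hunit : ∀ i, ∑ a, s i a ^ 2 = 1) (hindep : LinearIndependent ℝ s)
    (C : Matrix (Fin r) (Fin r) ℝ) (hC : ∀ j k, C j k = ∑ a, s j a * s k a)
    (u : Fin d → ℝ) (huunit : ∑ a, u a ^ 2 = 1)
    (huspan : u ∈ Submodule.span ℝ (Set.range s))
    (b : Fin r → ℝ) (hb : ∀ j, b j = ∑ a, u a * s j a)
    (x : Fin r → ℝ) (hx : x = C⁻¹.mulVec b)
    (ε : ℝ) (hε0 : 0 < ε) (hε1 : ε ≤ 1)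
    (Ctil : Matrix (Fin r) (Fin r) ℝ) (btil : Fin r → ℝ)
    (hCtil : ∀ j k, |Ctil j k - C j k| ≤
      ε / (6 * (r : ℝ) ^ 2 * ‖Matrix.toEuclideanCLM (𝕜 := ℝ) C⁻¹‖ ^ 2))
    (hbtil : ∀ j, |btil j - b j| ≤
      ε / (6 * (r : ℝ) * ‖Matrix.toEuclideanCLM (𝕜 := ℝ) C⁻¹‖)) :
    IsUnit Ctil ∧
    Real.sqrt (∑ a, ((∑ j, Ctil⁻¹.mulVec btil j * s j a) - u a) ^ 2) ≤ ε / 2 := by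
  set K := ‖Matrix.toEuclideanCLM (𝕜 := ℝ) C⁻¹‖ with hK
  have hCunit : IsUnit C := isUnit_of_linearIndependent_of_apply_eq_sum hindep hC
  have hux : ∀ a, u a = ∑ j, x j * s j a := by
    obtain ⟨c, hc⟩ := (Submodule.mem_span_range_iff_exists_fun ℝ).1 huspan
    have hca : ∀ a, u a = ∑ j, c j * s j a := fun a => by simp [← hc]
    have hbc : b = C.mulVec c := by
      ext j
      simp only [hb, hca, Matrix.mulVec, dotProduct, hC, Finset.sum_mul]
      rw [Finset.sum_comm]
      exact Finset.sum_congr rfl fun k _ => Finset.sum_congr rfl fun a _ => by ring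
    have hxc : x = c := by
      rw [hx, hbc, Matrix.mulVec_mulVec,
        Matrix.nonsing_inv_mul _ ((Matrix.isUnit_iff_isUnit_det _).1 hCunit), Matrix.one_mulVec]
    rwa [hxc]
  have hr : 0 < r := by
    rcases Nat.eq_zero_or_pos r with rfl | h
    · simp [hux] at huunit
    · exact h
  have hr1 : (1 : ℝ) ≤ r := by exact_mod_cast hr
  have hinv := norm_toLp_le_norm_inv_mul_norm_mulVec hCunit
  rw [← hK] at hinv
  have hCabs : ∀ j k, |C j k| ≤ 1 := fun j k => by
    rw [hC]; exact abs_sum_mul_le_one (hunit j) (hunit k)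
  have hKr : 1 ≤ r * K := by
    let e : Fin r → ℝ := Pi.single ⟨0, hr⟩ 1
    have he : ‖WithLp.toLp 2 e‖ = 1 := by
      simp [e]
    have h1 := hinv e
    have h2 := norm_toLp_mulVec_le_of_abs_le zero_le_one hCabs e
    rw [he] at h1 h2
    rw [Fintype.card_fin] at h2
    nlinarith [norm_nonneg (Matrix.toEuclideanCLM (𝕜 := ℝ) C⁻¹)]
  have hKpos : 0 < K := pos_of_mul_pos_right (by linarith) (by linarith : (0 : ℝ) ≤ r)
  have hE : ∀ v : Fin r → ℝ, ‖WithLp.toLp 2 ((Ctil - C).mulVec v)‖ ≤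
      ε / (6 * r * K ^ 2) * ‖WithLp.toLp 2 v‖ := fun v => by
    refine (norm_toLp_mulVec_le_of_abs_le (by positivity) hCtil v).trans_eq ?_
    rw [Fintype.card_fin]
    field_simp
  have hKE : ∀ v : Fin r → ℝ, K * ‖WithLp.toLp 2 ((Ctil - C).mulVec v)‖ ≤
      ‖WithLp.toLp 2 v‖ / 6 := fun v => by
    have hcoef : K * (ε / (6 * r * K ^ 2)) ≤ 1 / 6 := by
      rw [show K * (ε / (6 * r * K ^ 2)) = ε / (6 * (r * K)) by field_simp,
        div_le_div_iff₀ (by positivity) (by norm_num)]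
      linarith
    calc _ ≤ K * (ε / (6 * r * K ^ 2) * ‖WithLp.toLp 2 v‖) :=
          mul_le_mul_of_nonneg_left (hE v) hKpos.le
      _ = K * (ε / (6 * r * K ^ 2)) * ‖WithLp.toLp 2 v‖ := by ring
      _ ≤ 1 / 6 * ‖WithLp.toLp 2 v‖ := mul_le_mul_of_nonneg_right hcoef (norm_nonneg _)
      _ = _ := by ring
  have hCtilunit : IsUnit Ctil := by
    rw [← Matrix.mulVec_injective_iff_isUnit]
    refine (injective_iff_map_eq_zero Ctil.mulVecLin).2 fun v hv => ?_
    have hCv : C.mulVec v = -(Ctil - C).mulVec v := by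
      rw [Matrix.sub_mulVec, ← Matrix.mulVecLin_apply Ctil, hv]; simp
    have h1 := hinv v
    rw [hCv, WithLp.toLp_neg, norm_neg] at h1
    have h2 : ‖WithLp.toLp 2 v‖ = 0 :=
      le_antisymm (by linarith [hKE v]) (norm_nonneg _)
    simpa using h2
  refine ⟨hCtilunit, ?_⟩
  set w := Ctil⁻¹.mulVec btil - x with hw
  have hsqrt : 0 < √(r : ℝ) := Real.sqrt_pos.2 (by linarith)
  have hsq : √(r : ℝ) * √(r : ℝ) = r := Real.mul_self_sqrt (by linarith)
  have hCx : C.mulVec x = b := by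
    rw [hx, Matrix.mulVec_mulVec,
      Matrix.mul_nonsing_inv _ ((Matrix.isUnit_iff_isUnit_det _).1 hCunit), Matrix.one_mulVec]
  have hCw : C.mulVec w = (btil - b) - (Ctil - C).mulVec x - (Ctil - C).mulVec w := by
    have h : Ctil.mulVec (Ctil⁻¹.mulVec btil) = btil := by
      rw [Matrix.mulVec_mulVec,
        Matrix.mul_nonsing_inv _ ((Matrix.isUnit_iff_isUnit_det _).1 hCtilunit),
        Matrix.one_mulVec]
    simp only [hw, Matrix.mulVec_sub, Matrix.sub_mulVec, h, hCx]
    abel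
  have hxnorm : ‖WithLp.toLp 2 x‖ ≤ K * √r := by
    refine (hinv x).trans (mul_le_mul_of_nonneg_left ?_ hKpos.le)
    have h := norm_toLp_le_of_abs_le zero_le_one fun j =>
      (hb j).symm ▸ abs_sum_mul_le_one huunit (hunit j)
    rwa [Fintype.card_fin, mul_one, ← hCx] at h
  have hbnorm : K * ‖WithLp.toLp 2 (btil - b)‖ ≤ ε / (6 * √r) := by
    have h := norm_toLp_le_of_abs_le (v := btil - b) (by positivity) hbtil
    rw [Fintype.card_fin] at h
    refine (mul_le_mul_of_nonneg_left h hKpos.le).trans_eq ?_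
    rw [← hsq, Real.sqrt_mul_self hsqrt.le]
    field_simp
  have hExnorm : K * ‖WithLp.toLp 2 ((Ctil - C).mulVec x)‖ ≤ ε / (6 * √r) := by
    have h := (hE x).trans (mul_le_mul_of_nonneg_left hxnorm (by positivity))
    refine (mul_le_mul_of_nonneg_left h hKpos.le).trans_eq ?_
    rw [← hsq, Real.sqrt_mul_self hsqrt.le]
    field_simp
  have hwnorm : ‖WithLp.toLp 2 w‖ ≤ ε / (2 * √r) := by
    have htri : ‖WithLp.toLp 2 (C.mulVec w)‖ ≤ ‖WithLp.toLp 2 (btil - b)‖ +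
        ‖WithLp.toLp 2 ((Ctil - C).mulVec x)‖ + ‖WithLp.toLp 2 ((Ctil - C).mulVec w)‖ := by
      rw [hCw, WithLp.toLp_sub, WithLp.toLp_sub 2 (btil - b)]
      exact (norm_sub_le _ _).trans (add_le_add_left (norm_sub_le _ _) _)
    have h := (hinv w).trans (mul_le_mul_of_nonneg_left htri hKpos.le)
    have hhalf : ε / (2 * √r) = 3 * (ε / (6 * √r)) := by field_simp; norm_num
    have hpos : 0 ≤ ε / (6 * √r) := by positivity
    linarith [hKE w]
  have hdiff : ∀ a, (∑ j, Ctil⁻¹.mulVec btil j * s j a) - u a = ∑ j, w j * s j a := fun a => by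
    simp [hux, hw, sub_mul]
  simp only [hdiff]
  calc √(∑ a, (∑ j, w j * s j a) ^ 2) ≤ ∑ j, |w j| := sqrt_sum_sq_sum_mul_le hunit w
    _ ≤ √r * ‖WithLp.toLp 2 w‖ := by
        simpa using sum_abs_le_sqrt_card_mul_norm_toLp w
    _ ≤ √r * (ε / (2 * √r)) := mul_le_mul_of_nonneg_left hwnorm hsqrt.le
    _ = ε / 2 := by field_simp
end

section
/- Let H be a nonzero real symmetric d×d matrix with columns h₁, …, h_d, and let u be a unit vector with Hu = λu for some λ ≠ 0. Then there exists an index i with h_i ≠ 0 such that ⟨u, h_i⟩² / ‖h_i‖² ≥ λ² / ‖H‖_F²; in other words, max_{i : h_i ≠ 0} (⟨u, h_i⟩/‖h_i‖)² ≥ λ²/‖H‖_F². -/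
open scoped BigOperators

/-- Let `H` be a nonzero real symmetric `d×d` matrix with columns `h₁, …, h_d`, and
let `u` be a unit vector with `Hu = λu`, `λ ≠ 0`.  Then there is an index `i` with
`hᵢ ≠ 0` such that `⟨u, hᵢ⟩²/‖hᵢ‖² ≥ λ²/‖H‖_F²`. -/
theorem exists_column_large_overlap {d : ℕ} (H : Matrix (Fin d) (Fin d) ℝ)
    (hH : H ≠ 0) (hsymm : H.IsSymm)
    (u : Fin d → ℝ) (huunit : ∑ a, u a ^ 2 = 1)
    (lam : ℝ) (hlam : lam ≠ 0) (heig : H.mulVec u = lam • u) :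
    ∃ i, (fun a => H a i) ≠ (0 : Fin d → ℝ) ∧
      lam ^ 2 / (∑ a, ∑ b, H a b ^ 2) ≤
        (∑ a, u a * H a i) ^ 2 / (∑ a, H a i ^ 2) := by
  have overlap (i : Fin d) : ∑ a, u a * H a i = lam * u i := by
    have h := congrFun heig i
    simp only [Matrix.mulVec, dotProduct, Pi.smul_apply, smul_eq_mul] at h
    rw [← h]
    exact Finset.sum_congr rfl fun a _ => by rw [hsymm.apply i a, mul_comm]
  have overlap_sum : ∑ i, (∑ a, u a * H a i) ^ 2 = lam ^ 2 := by
    simp only [overlap, mul_pow, ← Finset.mul_sum, huunit, mul_one]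
  have norm_pos (i : Fin d) (hi : (fun a => H a i) ≠ 0) : 0 < ∑ a, H a i ^ 2 := by
    obtain ⟨a, ha⟩ := Function.ne_iff.mp hi
    exact Finset.sum_pos' (fun _ _ => sq_nonneg _) ⟨a, Finset.mem_univ a, sq_pos_of_ne_zero ha⟩
  obtain ⟨j, hj⟩ : ∃ j, (fun a => H a j) ≠ 0 := by
    by_contra! h
    exact hH (Matrix.ext fun a b => congrFun (h b) a)
  rw [Finset.sum_comm]
  have frob_pos : 0 < ∑ i, ∑ a, H a i ^ 2 :=
    Finset.sum_pos' (fun _ _ => Finset.sum_nonneg fun _ _ => sq_nonneg _)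
      ⟨j, Finset.mem_univ j, norm_pos j hj⟩
  by_contra! h
  have lt_of_ne (i : Fin d) (hi : (fun a => H a i) ≠ 0) :
      (∑ a, u a * H a i) ^ 2 * (∑ i, ∑ a, H a i ^ 2) < lam ^ 2 * ∑ a, H a i ^ 2 :=
    (div_lt_div_iff₀ (norm_pos i hi) frob_pos).mp (h i hi)
  have sum_lt : ∑ i, (∑ a, u a * H a i) ^ 2 * (∑ i, ∑ a, H a i ^ 2) <
      ∑ i, lam ^ 2 * ∑ a, H a i ^ 2 := by
    refine Finset.sum_lt_sum (fun i _ => ?_) ⟨j, Finset.mem_univ j, lt_of_ne j hj⟩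
    by_cases hi : (fun a => H a i) = 0
    · have column_zero (a : Fin d) : H a i = 0 := congrFun hi a
      simp [column_zero]
    · exact (lt_of_ne i hi).le
  rw [← Finset.sum_mul, ← Finset.mul_sum, overlap_sum] at sum_lt
  exact lt_irrefl _ sum_lt
end
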